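/- There exists a universal constant C > 0 such that for every n and all k, x ∈ {0,...,n} with k ≥ 1, x ≥ 1, k ≤ n/2, and x ≤ n/2, one has |κ_k^{(n)}(x)| ≤ C · n/(kx). -/

import Mathlib

/-- The normalized Krawtchouk polynomial `κ_k^{(n)}(x)`. -/
noncomputable def kraw (n k x : ℕ) : ℝ :=
  ((n.choose k : ℝ))⁻¹ *
    ∑ j ∈ Finset.range (k + 1), (-1 : ℝ) ^ j * (x.choose j) * ((n - x).choose (k - j))

open Polynomial in
lemma kraw_coeff_sub (x j : ℕ) : ((1 - X : ℝ[X]) ^ x).coeff j = (-1 : ℝ) ^ j * x.choose j := by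
  have h : (1 - X : ℝ[X]) ^ x = ((1 + X : ℝ[X]) ^ x).comp (C (-1) * X) := by
    simp [sub_eq_add_neg]
  rw [h, comp_C_mul_X_coeff, coeff_one_add_X_pow]
  ring

open Polynomial in
lemma kraw_sum_eq (m k x : ℕ) :
    ∑ j ∈ Finset.range (k + 1), (-1 : ℝ) ^ j * (x.choose j) * ((2 * x + m - x).choose (k - j))
      = ((1 - X ^ 2 : ℝ[X]) ^ x * (1 + X) ^ m).coeff k := by
  have h : (1 - X ^ 2 : ℝ[X]) ^ x * (1 + X) ^ m = (1 - X) ^ x * (1 + X) ^ (2 * x + m - x) := by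
    have e : 2 * x + m - x = x + m := by omega
    rw [e, pow_add, ← mul_assoc, ← mul_pow]
    congr 2
    ring
  rw [h, coeff_mul, Finset.Nat.sum_antidiagonal_eq_sum_range_succ_mk]
  refine Finset.sum_congr rfl fun j _ => ?_
  rw [kraw_coeff_sub, coeff_one_add_X_pow]

open Polynomial in
lemma kraw_abs_le (m x : ℕ) : ∀ k, |((1 - X ^ 2 : ℝ[X]) ^ x * (1 + X) ^ m).coeff k|
      ≤ ((1 + X ^ 2 : ℝ[X]) ^ x * (1 + X) ^ m).coeff k := by
  induction x with
  | zero => intro k; simp [coeff_one_add_X_pow]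
  | succ x ih =>
    intro k
    have e1 : (1 - X ^ 2 : ℝ[X]) ^ (x + 1) * (1 + X) ^ m
        = (1 - X ^ 2 : ℝ[X]) ^ x * (1 + X) ^ m - ((1 - X ^ 2 : ℝ[X]) ^ x * (1 + X) ^ m) * X ^ 2 := by
      ring
    have e2 : (1 + X ^ 2 : ℝ[X]) ^ (x + 1) * (1 + X) ^ m
        = (1 + X ^ 2 : ℝ[X]) ^ x * (1 + X) ^ m + ((1 + X ^ 2 : ℝ[X]) ^ x * (1 + X) ^ m) * X ^ 2 := by
      ring
    rw [e1, e2, coeff_sub, coeff_add, coeff_mul_X_pow', coeff_mul_X_pow']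
    refine (abs_sub _ _).trans (add_le_add (ih k) ?_)
    split_ifs
    · exact ih _
    · simp

lemma kraw_moment {R : Type*} [CommRing R] (a b : R) (x : ℕ) (g : ℕ → R) :
    ∑ j ∈ Finset.range (x + 2), (j : R) * g j * (a ^ j * b ^ (x + 1 - j) * ((x + 1).choose j : R))
    = (x + 1 : R) * a * ∑ j ∈ Finset.range (x + 1), g (j + 1) * (a ^ j * b ^ (x - j) * (x.choose j : R)) := by
  rw [Finset.sum_range_succ', Finset.mul_sum]
  simp only [Nat.cast_zero, zero_mul, add_zero]
  refine Finset.sum_congr rfl fun j _ => ?_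
  have h : ((x + 1 : R)) * (x.choose j : R) = ((x + 1).choose (j + 1) : R) * ((j : R) + 1) := by
    exact_mod_cast congrArg (Nat.cast : ℕ → R) (Nat.add_one_mul_choose_eq x j)
  have e : x + 1 - (j + 1) = x - j := by omega
  rw [e, pow_succ]
  push_cast
  linear_combination (- g (j + 1) * a ^ j * a * b ^ (x - j)) * h

lemma kraw_m0 {R : Type*} [CommRing R] (a b : R) (x : ℕ) :
    ∑ j ∈ Finset.range (x + 1), (a ^ j * b ^ (x - j) * (x.choose j : R)) = (a + b) ^ x :=
  (add_pow a b x).symm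

lemma kraw_m1 {R : Type*} [CommRing R] (a b : R) (x : ℕ) :
    ∑ j ∈ Finset.range (x + 2), (j : R) * (a ^ j * b ^ (x + 1 - j) * ((x + 1).choose j : R))
    = (x + 1 : R) * a * (a + b) ^ x := by
  have := kraw_moment a b x (fun _ => 1)
  simpa [kraw_m0] using this

lemma kraw_m2 {R : Type*} [CommRing R] (a b : R) (x : ℕ) :
    ∑ j ∈ Finset.range (x + 3),
      (j : R) * ((j : R) - 1) * (a ^ j * b ^ (x + 2 - j) * ((x + 2).choose j : R))
    = (x + 2 : R) * (x + 1) * a ^ 2 * (a + b) ^ x := by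
  have := kraw_moment a b (x + 1) (fun j => (j : R) - 1)
  rw [this]
  have h2 := kraw_m1 a b x
  simp only [Nat.cast_add, Nat.cast_one, add_sub_cancel_right]
  rw [h2]
  ring

open Polynomial in
lemma kraw_c2 : (C 2 : ℝ[X]) = 2 := by exact_mod_cast C_eq_natCast (R := ℝ) 2

open Polynomial in
lemma kraw_c4 : (C 4 : ℝ[X]) = 4 := by exact_mod_cast C_eq_natCast (R := ℝ) 4

open Polynomial in
/-- weights -/
noncomputable def krawW (m k x j : ℕ) : ℝ :=
  (((2 * X : ℝ[X]) ^ j * (1 + X ^ 2) ^ (x - j) * (x.choose j : ℝ[X])) * (1 + X) ^ m).coeff k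

open Polynomial in
lemma kraw_coeff_nonneg_mul {p q : ℝ[X]} (hp : ∀ i, 0 ≤ p.coeff i) (hq : ∀ i, 0 ≤ q.coeff i) :
    ∀ i, 0 ≤ (p * q).coeff i := by
  intro i
  rw [coeff_mul]
  exact Finset.sum_nonneg fun a _ => mul_nonneg (hp _) (hq _)

open Polynomial in
lemma kraw_coeff_nonneg_pow {p : ℝ[X]} (hp : ∀ i, 0 ≤ p.coeff i) (s : ℕ) :
    ∀ i, 0 ≤ (p ^ s).coeff i := by
  induction s with
  | zero => intro i; rw [pow_zero, coeff_one]; split_ifs <;> norm_num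
  | succ s ih => rw [pow_succ]; exact kraw_coeff_nonneg_mul ih hp

open Polynomial in
lemma krawW_nonneg (m k x j : ℕ) : 0 ≤ krawW m k x j := by
  unfold krawW
  refine kraw_coeff_nonneg_mul (kraw_coeff_nonneg_mul (kraw_coeff_nonneg_mul
    (kraw_coeff_nonneg_pow ?_ _) (kraw_coeff_nonneg_pow ?_ _)) ?_) (kraw_coeff_nonneg_pow ?_ _) k
  · intro i
    rw [show (2 * X : ℝ[X]) = C 2 * X by rw [kraw_c2], coeff_C_mul, coeff_X]
    split_ifs <;> norm_num
  · intro i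
    rw [coeff_add, coeff_one, coeff_X_pow]
    split_ifs <;> norm_num
  · intro i
    rw [← C_eq_natCast, coeff_C]
    split_ifs <;> positivity
  · intro i
    rw [coeff_add, coeff_one, coeff_X]
    split_ifs <;> norm_num

open Polynomial in
lemma krawW_zero (m k x : ℕ) :
    krawW m k x 0 = ((1 + X ^ 2 : ℝ[X]) ^ x * (1 + X) ^ m).coeff k := by
  simp [krawW]

open Polynomial in
lemma krawW_s0 (m k x : ℕ) :
    ∑ j ∈ Finset.range (x + 1), krawW m k x j = ((2 * x + m).choose k : ℝ) := by
  unfold krawW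
  rw [← finsetSum_coeff, ← Finset.sum_mul, kraw_m0,
    show (2 * X + (1 + X ^ 2) : ℝ[X]) = (1 + X) ^ 2 by ring, ← pow_mul, ← pow_add,
    coeff_one_add_X_pow]

open Polynomial in
lemma krawW_s1 (m k x : ℕ) :
    ∑ j ∈ Finset.range (x + 2), (j : ℝ) * krawW m (k + 1) (x + 1) j
      = 2 * (x + 1) * ((2 * x + m).choose k : ℝ) := by
  have h := congrArg (fun p : ℝ[X] => (p * (1 + X) ^ m).coeff (k + 1))
    (kraw_m1 (2 * X : ℝ[X]) (1 + X ^ 2) x)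
  simp only [Finset.sum_mul, finsetSum_coeff] at h
  rw [show ((x : ℝ[X]) + 1) * (2 * X) * (2 * X + (1 + X ^ 2)) ^ x * (1 + X) ^ m
      = C (2 * ((x : ℝ) + 1)) * ((1 + X) ^ (2 * x + m) * X) by
      rw [show (2 * X + (1 + X ^ 2) : ℝ[X]) = (1 + X) ^ 2 by ring, pow_add, pow_mul]
      simp [kraw_c2, kraw_c4]; ring, coeff_C_mul, coeff_mul_X, coeff_one_add_X_pow] at h
  rw [← h]
  refine Finset.sum_congr rfl fun j _ => ?_
  rw [krawW, mul_assoc (j : ℝ[X]), ← C_eq_natCast j, coeff_C_mul]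

open Polynomial in
lemma krawW_s2 (m k x : ℕ) :
    ∑ j ∈ Finset.range (x + 3), (j : ℝ) * ((j : ℝ) - 1) * krawW m (k + 2) (x + 2) j
      = 4 * (x + 2) * (x + 1) * ((2 * x + m).choose k : ℝ) := by
  have h := congrArg (fun p : ℝ[X] => (p * (1 + X) ^ m).coeff (k + 2))
    (kraw_m2 (2 * X : ℝ[X]) (1 + X ^ 2) x)
  simp only [Finset.sum_mul, finsetSum_coeff] at h
  rw [show ((x : ℝ[X]) + 2) * ((x : ℝ[X]) + 1) * (2 * X) ^ 2 * (2 * X + (1 + X ^ 2)) ^ x * (1 + X) ^ m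
      = C (4 * ((x : ℝ) + 2) * (x + 1)) * ((1 + X) ^ (2 * x + m) * X ^ 2) by
      rw [show (2 * X + (1 + X ^ 2) : ℝ[X]) = (1 + X) ^ 2 by ring, pow_add, pow_mul]
      simp [kraw_c2, kraw_c4]; ring, coeff_C_mul, coeff_mul_X_pow, coeff_one_add_X_pow] at h
  rw [← h]
  refine Finset.sum_congr rfl fun j _ => ?_
  rw [krawW, mul_assoc ((j : ℝ[X]) * _),
    show (j : ℝ[X]) * ((j : ℝ[X]) - 1) = C ((j : ℝ) * ((j : ℝ) - 1)) by simp, coeff_C_mul]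

/-- Chebyshev -/
lemma kraw_cheb (m k x : ℕ) (M : ℝ) :
    krawW m (k + 2) (x + 2) 0 * M ^ 2 ≤ 4 * (x + 2) * (x + 1) * ((2 * x + m).choose k : ℝ)
      + (1 - 2 * M) * (2 * (x + 2) * ((2 * x + m + 2).choose (k + 1) : ℝ))
      + M ^ 2 * ((2 * x + m + 4).choose (k + 2) : ℝ) := by
  have h0 := krawW_s0 m (k + 2) (x + 2)
  have h1 := krawW_s1 m (k + 1) (x + 1)
  have h2 := krawW_s2 m k x
  rw [show 2 * (x + 2) + m = 2 * x + m + 4 by ring] at h0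
  rw [show 2 * (x + 1) + m = 2 * x + m + 2 by ring] at h1
  push_cast at h1
  rw [show (x : ℝ) + 1 + 1 = x + 2 by ring] at h1
  rw [← h0, ← h1, ← h2, Finset.mul_sum, Finset.mul_sum, ← Finset.sum_add_distrib,
    ← Finset.sum_add_distrib]
  have := Finset.single_le_sum (f := fun j : ℕ => ((j : ℝ) - M) ^ 2 * krawW m (k + 2) (x + 2) j)
    (s := Finset.range (x + 3)) (fun j _ => mul_nonneg (sq_nonneg _) (krawW_nonneg _ _ _ _))
    (Finset.mem_range.2 (show 0 < x + 3 by omega))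
  refine le_trans (le_of_eq ?_) (this.trans (le_of_eq ?_))
  · simp; ring
  · refine Finset.sum_congr rfl fun j _ => ?_
    ring

lemma kraw_choose (n k : ℕ) (h : k ≤ n) :
    ((n : ℝ) + 2) * (n + 1) * (n.choose k : ℝ)
      = (k + 1) * (n + 1 - k) * ((n + 2).choose (k + 1) : ℝ) := by
  have h1 : ((n : ℝ) + 2) * ((n + 1).choose k : ℝ) = ((n + 2).choose (k + 1) : ℝ) * (k + 1) := by
    exact_mod_cast Nat.add_one_mul_choose_eq (n + 1) k
  have h2 : (n.choose k : ℝ) * (n + 1) = ((n + 1).choose k : ℝ) * (n + 1 - k) := by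
    have := Nat.choose_mul_succ_eq n k
    have e : ((n + 1 - k : ℕ) : ℝ) = n + 1 - k := by
      rw [Nat.cast_sub (by omega)]; push_cast; ring
    rw [← e]
    exact_mod_cast this
  linear_combination ((n : ℝ) + 2) * h2 + ((n : ℝ) + 1 - k) * h1

lemma kraw_real (n k x W N B D : ℝ) (hn : 4 ≤ n) (hk : 2 ≤ k) (hx : 2 ≤ x) (hkn : k ≤ n / 2)
    (hxn : x ≤ n / 2) (hN : 0 < N)
    (hB : n * (n - 1) * B = k * (n - k) * N)
    (hD : (n - 2) * (n - 3) * D = (k - 1) * (n - k - 1) * B)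
    (hc : ∀ M : ℝ, W * M ^ 2 ≤ 4 * x * (x - 1) * D + (1 - 2 * M) * (2 * x * B) + M ^ 2 * N) :
    W ≤ 2 * n / (k * x) * N := by
  have hBpos : 0 < B := by
    have h : 0 < k * (n - k) * N := mul_pos (mul_pos (by linarith) (by linarith)) hN
    rw [← hB] at h
    exact pos_of_mul_pos_right h (by nlinarith)
  have hDpos : 0 ≤ D := by
    have h : 0 ≤ (k - 1) * (n - k - 1) * B :=
      mul_nonneg (mul_nonneg (by linarith) (by linarith)) hBpos.le
    rw [← hD] at h
    exact nonneg_of_mul_nonneg_right h (by nlinarith)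
  have hDN : n * (n - 3) * (D * N) ≤ (n ^ 2 - 3 * n + 2) * B ^ 2 := by
    have e : (k * (n - k) * (n - 2)) * (n * (n - 3) * (D * N)) =
      n * (k - 1) * (n - k - 1) * (n * (n - 1)) * B ^ 2 := by
      linear_combination (-(n * (n - 3) * (n - 2) * D)) * hB + n * n * (n - 1) * B * hD
    have hp : 0 < k * (n - k) * (n - 2) :=
      mul_pos (mul_pos (by linarith) (by linarith)) (by linarith)
    refine le_of_mul_le_mul_left ?_ hp
    rw [e, ← mul_assoc (k * (n - k) * (n - 2))]
    refine mul_le_mul_of_nonneg_right ?_ (sq_nonneg B)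
    have : k * (n - k) * (n - 2) * (n ^ 2 - 3 * n + 2) - n * (k - 1) * (n - k - 1) * (n * (n - 1))
      = (n - 1) * (n - 1) * (n - 2 * k) ^ 2 := by
      ring
    nlinarith [mul_nonneg (mul_self_nonneg (n-1)) (sq_nonneg (n - 2 * k))]
  -- choose M = 2 x B / N
  have h := hc (2 * x * B / N)
  have h' : W * (4 * x ^ 2 * B ^ 2) ≤ 4 * x * (x - 1) * (D * N) * N + 2 * x * B * N ^ 2
      - 4 * x ^ 2 * B ^ 2 * N := by
    have := mul_le_mul_of_nonneg_right h (sq_nonneg N)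
    field_simp at this
    nlinarith
  have hxB : 0 < x * B := mul_pos (by linarith) hBpos
  have hn0 : 0 < n := by linarith
  have hk0 : 0 < k := by linarith
  have hx0 : 0 < x := by linarith
  -- D N ≤ (1 + 2 / n) B²
  have a1 : n * (D * N) ≤ (n + 2) * B ^ 2 := by
    refine le_of_mul_le_mul_left ?_ (show 0 < n - 3 by linarith)
    have : (n ^ 2 - 3 * n + 2) * B ^ 2 ≤ (n - 3) * (n + 2) * B ^ 2 :=
      mul_le_mul_of_nonneg_right (by nlinarith) (sq_nonneg B)
    linarith
  have a2 : k * N ≤ 2 * n * B := by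
    refine le_of_mul_le_mul_left ?_ (show 0 < n - k by linarith)
    have : n * B * (n - 1) ≤ n * B * (2 * (n - k)) :=
      mul_le_mul_of_nonneg_left (by linarith) (by positivity)
    linarith
  have a3 : 4 * x * (x - 1) * (D * N) * N ≤ 4 * x ^ 2 * (D * N) * N := by
    have : 0 ≤ 4 * x * (D * N) * N := by positivity
    linarith
  -- multiply by n * k
  have a4 : (n * k * W) * (4 * x ^ 2 * B ^ 2) ≤
      (8 * k * x ^ 2 * N + 4 * n ^ 2 * x * N) * B ^ 2 := by
    have b1 := mul_le_mul_of_nonneg_left (h'.trans (sub_le_sub_right (add_le_add_left a3 _) _))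
      (show 0 ≤ n * k by positivity)
    have b2 := mul_le_mul_of_nonneg_left a1 (show 0 ≤ k * (4 * x ^ 2) * N by positivity)
    have b3 := mul_le_mul_of_nonneg_left a2 (show 0 ≤ n * (2 * x * B * N) by positivity)
    linarith
  have a5 : (n * k * W) * (4 * x ^ 2) ≤ 8 * k * x ^ 2 * N + 4 * n ^ 2 * x * N := by
    refine le_of_mul_le_mul_right ?_ (show 0 < B ^ 2 by positivity)
    linarith
  have a6 : 2 * (k * x) ≤ n ^ 2 := by nlinarith
  rw [div_mul_eq_mul_div, le_div_iff₀ (by positivity)]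
  refine le_of_mul_le_mul_right ?_ (show 0 < 4 * x * n by positivity)
  have a7 := mul_le_mul_of_nonneg_left a6 (show 0 ≤ 4 * x * N by positivity)
  linarith

theorem statement17 :
    ∃ C : ℝ, 0 < C ∧ ∀ n k x : ℕ, 1 ≤ k → 1 ≤ x →
      (k : ℝ) ≤ (n : ℝ) / 2 → (x : ℝ) ≤ (n : ℝ) / 2 →
      |kraw n k x| ≤ C * n / (k * x) := by
  refine ⟨2, by norm_num, ?_⟩
  intro n k x hk hx hkn hxn
  have hkn' : 2 * k ≤ n := by
    have : (2 * k : ℝ) ≤ n := by linarith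
    exact_mod_cast this
  have hxn' : 2 * x ≤ n := by
    have : (2 * x : ℝ) ≤ n := by linarith
    exact_mod_cast this
  obtain ⟨m, rfl⟩ := Nat.exists_eq_add_of_le hxn'
  have hN : (0 : ℝ) < ((2 * x + m).choose k : ℝ) := by
    exact_mod_cast Nat.choose_pos (by omega)
  have hkx : (0 : ℝ) < (k : ℝ) * x := by positivity
  suffices h : krawW m k x 0 ≤ 2 * ((2 * x + m : ℕ) : ℝ) / (k * x) * ((2 * x + m).choose k : ℝ) by
    rw [kraw, kraw_sum_eq, abs_mul, abs_of_pos (inv_pos.2 hN), inv_mul_le_iff₀ hN]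
    refine (kraw_abs_le m x k).trans ?_
    rw [← krawW_zero]
    exact h.trans (le_of_eq (mul_comm _ _))
  have htriv : krawW m k x 0 ≤ ((2 * x + m).choose k : ℝ) := by
    rw [← krawW_s0]
    exact Finset.single_le_sum (f := krawW m k x) (fun j _ => krawW_nonneg _ _ _ _)
      (Finset.mem_range.2 (by omega))
  by_cases hsm : k = 1 ∨ x = 1
  · refine htriv.trans (le_mul_of_one_le_left hN.le ?_)
    rw [one_le_div hkx]
    have : k * x ≤ 2 * (2 * x + m) := by
      rcases hsm with rfl | rfl <;> omega
    exact_mod_cast this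
  obtain ⟨k, rfl⟩ : ∃ k', k = k' + 2 := ⟨k - 2, by omega⟩
  obtain ⟨x, rfl⟩ : ∃ x', x = x' + 2 := ⟨x - 2, by omega⟩
  have hB := kraw_choose (2 * x + m + 2) (k + 1) (by omega)
  have hD := kraw_choose (2 * x + m) k (by omega)
  have hc := kraw_cheb m k x
  have e : 2 * (x + 2) + m = 2 * x + m + 4 := by ring
  rw [e] at hN hkn hxn ⊢
  have hx0 : (0 : ℝ) ≤ x := Nat.cast_nonneg _
  have hk0 : (0 : ℝ) ≤ k := Nat.cast_nonneg _
  have hm0 : (0 : ℝ) ≤ m := Nat.cast_nonneg _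
  push_cast at hB hD hc hkn hxn ⊢
  refine kraw_real (2 * x + m + 4) (k + 2) (x + 2) _ _ ((2 * x + m + 2).choose (k + 1) : ℝ)
    ((2 * x + m).choose k : ℝ) (by linarith) (by linarith) (by linarith) hkn hxn hN ?_ ?_ ?_
  · linear_combination hB
  · linear_combination hD
  · intro M
    refine (hc M).trans (le_of_eq ?_)
    ring
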